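/- Let P₁, P₂ be probability functions over a finite set of arguments 𝒜 with P₁ ≡ P₂ (atomically equivalent), and let C be a finite satisfiable set of linear atomic constraints over 𝒜. Then the two-stage least-squares updates are atomically equivalent: 𝒰²_At(P₁,C) ≡ 𝒰²_At(P₂,C), i.e., they assign the same probability to every argument A ∈ 𝒜. -/

import Mathlib

open Finset

/-- A probability function over the possible worlds `Ω = 2^𝒜` (represented as `Finset α`):
maps each world into `[0,1]` and sums to `1`. -/
def IsProbFun {α : Type*} [Fintype α] (P : Finset α → ℝ) : Prop :=
  (∀ w, 0 ≤ P w ∧ P w ≤ 1) ∧ ∑ w : Finset α, P w = 1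

/-- The probability of an argument `A` under `P`: the sum of the probabilities of all
worlds accepting `A`. -/
def argProb {α : Type*} [Fintype α] [DecidableEq α] (P : Finset α → ℝ) (A : α) : ℝ :=
  ∑ w : Finset α, if A ∈ w then P w else 0

/-- A probability function satisfies the linear atomic constraint `c = ((c_A)_A, c₀)`
iff `∑_A c_A · P(A) ≤ c₀`. -/
def SatP {α : Type*} [Fintype α] [DecidableEq α] (P : Finset α → ℝ)
    (c : (α → ℚ) × ℚ) : Prop :=
  ∑ A : α, (c.1 A : ℝ) * argProb P A ≤ (c.2 : ℝ)

/-- `sat_Π(C)`: the set of probability functions satisfying every constraint in `C`. -/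
def satPi {α : Type*} [Fintype α] [DecidableEq α] (C : Finset ((α → ℚ) × ℚ)) :
    Set (Finset α → ℝ) :=
  {P | IsProbFun P ∧ ∀ c ∈ C, SatP P c}

/-- The atomic least-squares distance `d²_At`. -/
def dAt {α : Type*} [Fintype α] [DecidableEq α] (P P' : Finset α → ℝ) : ℝ :=
  ∑ A : α, (argProb P A - argProb P' A) ^ 2

/-- `u_At(P,C)`: the ALS-distance minimizers to `P` within `sat_Π(C)`. -/
def uAt {α : Type*} [Fintype α] [DecidableEq α] (P : Finset α → ℝ)
    (C : Finset ((α → ℚ) × ℚ)) : Set (Finset α → ℝ) :=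
  {P' ∈ satPi C | ∀ Q ∈ satPi C, dAt P P' ≤ dAt P Q}

/-- The (world-wise) least-squares distance `∑_{w ∈ Ω} (P(w) - P'(w))²`. -/
def wDist {α : Type*} [Fintype α] (P P' : Finset α → ℝ) : ℝ :=
  ∑ w : Finset α, (P w - P' w) ^ 2

/-- A probability labelling: maps each argument into `[0,1]`. -/
def IsLab {α : Type*} (L : α → ℝ) : Prop := ∀ A, 0 ≤ L A ∧ L A ≤ 1

/-- A probability labelling satisfies the linear atomic constraint `c = ((c_A)_A, c₀)`
iff `∑_A c_A · L(A) ≤ c₀`. -/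
def SatL {α : Type*} [Fintype α] (L : α → ℝ) (c : (α → ℚ) × ℚ) : Prop :=
  ∑ A : α, (c.1 A : ℝ) * L A ≤ (c.2 : ℝ)

/-- `sat_Λ(C)`: the set of probability labellings satisfying every constraint in `C`. -/
def satLam {α : Type*} [Fintype α] (C : Finset ((α → ℚ) × ℚ)) : Set (α → ℝ) :=
  {L | IsLab L ∧ ∀ c ∈ C, SatL L c}

section Midpoint

variable {α : Type*} [Fintype α]

lemma IsProbFun.midpoint {P Q : Finset α → ℝ} (hP : IsProbFun P) (hQ : IsProbFun Q) :
    IsProbFun (fun w => (P w + Q w) / 2) := by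
  refine ⟨fun w => ?_, ?_⟩
  · have hp := hP.1 w
    have hq := hQ.1 w
    constructor <;> linarith
  · rw [← Finset.sum_div, Finset.sum_add_distrib, hP.2, hQ.2]
    norm_num

variable [DecidableEq α]

lemma argProb_midpoint (P Q : Finset α → ℝ) (A : α) :
    argProb (fun w => (P w + Q w) / 2) A = (argProb P A + argProb Q A) / 2 := by
  unfold argProb
  rw [← Finset.sum_add_distrib, Finset.sum_div]
  refine Finset.sum_congr rfl fun w _ => ?_
  split_ifs <;> simp

lemma SatP.midpoint {P Q : Finset α → ℝ} {c : (α → ℚ) × ℚ} (hP : SatP P c) (hQ : SatP Q c) :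
    SatP (fun w => (P w + Q w) / 2) c := by
  unfold SatP at *
  have h : ∑ A : α, (c.1 A : ℝ) * argProb (fun w => (P w + Q w) / 2) A =
      (∑ A : α, (c.1 A : ℝ) * argProb P A + ∑ A : α, (c.1 A : ℝ) * argProb Q A) / 2 := by
    rw [← Finset.sum_add_distrib, Finset.sum_div]
    refine Finset.sum_congr rfl fun A _ => ?_
    rw [argProb_midpoint]
    ring
  linarith

lemma satPi_midpoint {C : Finset ((α → ℚ) × ℚ)} {P Q : Finset α → ℝ} (hP : P ∈ satPi C)
    (hQ : Q ∈ satPi C) : (fun w => (P w + Q w) / 2) ∈ satPi C :=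
  ⟨hP.1.midpoint hQ.1, fun c hc => (hP.2 c hc).midpoint (hQ.2 c hc)⟩

/-- The parallelogram identity for the atomic least-squares distance. -/
lemma dAt_midpoint (P Q R : Finset α → ℝ) :
    dAt P (fun w => (Q w + R w) / 2) = (dAt P Q + dAt P R) / 2 - dAt Q R / 4 := by
  unfold dAt
  rw [← Finset.sum_add_distrib, Finset.sum_div, Finset.sum_div, ← Finset.sum_sub_distrib]
  refine Finset.sum_congr rfl fun A _ => ?_
  rw [argProb_midpoint]
  ring

lemma argProb_eq_of_dAt_nonpos {P Q : Finset α → ℝ} (h : dAt P Q ≤ 0) (A : α) :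
    argProb P A = argProb Q A := by
  have h' : (argProb P A - argProb Q A) ^ 2 ≤ dAt P Q :=
    Finset.single_le_sum (f := fun A => (argProb P A - argProb Q A) ^ 2)
      (fun _ _ => sq_nonneg _) (Finset.mem_univ A)
  exact sub_eq_zero.mp (pow_eq_zero_iff two_ne_zero |>.mp
    (le_antisymm (h'.trans h) (sq_nonneg _)))

lemma dAt_congr_left {P₁ P₂ : Finset α → ℝ} (h : ∀ A, argProb P₁ A = argProb P₂ A)
    (Q : Finset α → ℝ) : dAt P₁ Q = dAt P₂ Q := by
  simp only [dAt, h]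

/-- All minimizers of the atomic least-squares distance are atomically equivalent. -/
lemma argProb_eq_of_mem_uAt {P Q R : Finset α → ℝ} {C : Finset ((α → ℚ) × ℚ)}
    (hQ : Q ∈ uAt P C) (hR : R ∈ uAt P C) (A : α) : argProb Q A = argProb R A := by
  have hM := hQ.2 _ (satPi_midpoint hQ.1 hR.1)
  rw [dAt_midpoint] at hM
  have hRQ := hR.2 Q hQ.1
  exact argProb_eq_of_dAt_nonpos (by linarith) A

end Midpoint

/-- the two-stage least-squares updates of atomically equivalent probability
functions are atomically equivalent. -/
theorem two_stage_update_atomEquiv {α : Type*} [Fintype α] [DecidableEq α]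
    (P₁ P₂ : Finset α → ℝ) (h₁ : IsProbFun P₁) (h₂ : IsProbFun P₂)
    (hEquiv : ∀ A : α, argProb P₁ A = argProb P₂ A)
    (C : Finset ((α → ℚ) × ℚ)) (hC : (satPi C).Nonempty)
    (Q₁ : Finset α → ℝ)
    (hQ₁ : Q₁ ∈ uAt P₁ C ∧ ∀ Q ∈ uAt P₁ C, wDist P₁ Q₁ ≤ wDist P₁ Q)
    (Q₂ : Finset α → ℝ)
    (hQ₂ : Q₂ ∈ uAt P₂ C ∧ ∀ Q ∈ uAt P₂ C, wDist P₂ Q₂ ≤ wDist P₂ Q) :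
    ∀ A : α, argProb Q₁ A = argProb Q₂ A := by
  have hmem : Q₂ ∈ uAt P₁ C :=
    ⟨hQ₂.1.1, fun Q hQ => by
      simpa only [dAt_congr_left hEquiv] using hQ₂.1.2 Q hQ⟩
  exact argProb_eq_of_mem_uAt hQ₁.1 hmem
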